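/- In SU(N) lattice gauge theory on the periodic d-dimensional hypercubic lattice Λ, if V and V′ are two distinct homologous vortices, then for all l, m ∈ {0,…,N−1}: ⟨F^[l][V] · F^[m][V′]⟩ = δ^{(N)}_{l,m} ⟨F^[l][V]⟩, where δ^{(N)}_{l,m} = 1 if l ≡ m (mod N) and 0 otherwise; in particular the electric-flux operators behave as a family of orthogonal projections, and Σ_{m=0}^{N−1} F^[m][V] = 1 identically. -/

import Mathlib

/-!
Setup: SU(N) lattice gauge theory on a periodic d-dimensional hypercubic lattice.
Sites are `(i : Fin d) → ZMod (L i)`; a configuration assigns an element of `SU N`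
to each link `(x, μ)`.  `Pm` is the product of the normalized Haar measure `μH`
(hypothesized as a left-invariant probability measure) over all links, and the
Gibbs weight is `exp ((β/N) Σ_p Re Tr U_p)`.  A vortex for directions `μ < ν` is
specified by coordinates `c1 : ZMod (L μ)`, `c2 : ZMod (L ν)`; `Ovort` is the
vortex creation operator, `Fop` the electric-flux operator, `Ztw` the twisted
partition function, and `rectHol` the holonomy around a rectangular loop.
-/

open MeasureTheory

namespace TYLGT

noncomputable instance (n : ℕ) : MeasurableSpace (Matrix (Fin n) (Fin n) ℂ) :=
  inferInstanceAs (MeasurableSpace (Fin n → Fin n → ℂ))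

/-- The special unitary group `SU(N)` as a subgroup of the unitary group of
`N × N` complex matrices. -/
def SU (N : ℕ) : Subgroup (Matrix.unitaryGroup (Fin N) ℂ) where
  carrier := {A | (A : Matrix (Fin N) (Fin N) ℂ).det = 1}
  mul_mem' := by
    intro a b ha hb
    simp only [Set.mem_setOf_eq, Matrix.UnitaryGroup.mul_val, Matrix.det_mul] at *
    rw [ha, hb, mul_one]
  one_mem' := by simp
  inv_mem' := by
    intro a ha
    simp only [Set.mem_setOf_eq] at *
    rw [Matrix.UnitaryGroup.inv_val, Matrix.star_eq_conjTranspose, Matrix.det_conjTranspose, ha,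
      star_one]

/-- The underlying matrix of an element of `SU(N)`. -/
def toM {N : ℕ} (U : SU N) : Matrix (Fin N) (Fin N) ℂ :=
  ((U : Matrix.unitaryGroup (Fin N) ℂ) : Matrix (Fin N) (Fin N) ℂ)

/-- `z = exp(2πi/N)`, the generator of the center `Z_N ⊆ SU(N)`. -/
noncomputable def zc (N : ℕ) : ℂ := Complex.exp (2 * Real.pi * Complex.I / N)

variable {d N : ℕ}

/-- Sites of the periodic hypercubic lattice with side lengths `L i`. -/
abbrev Site (L : Fin d → ℕ) := (i : Fin d) → ZMod (L i)

/-- A lattice gauge field configuration: one `SU(N)` element per link `(x, μ)`. -/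
abbrev Config (L : Fin d → ℕ) (N : ℕ) := (Site L × Fin d) → SU N

/-- The unit lattice vector in direction `μ`. -/
def e (L : Fin d → ℕ) (μ : Fin d) : Site L := fun i => if i = μ then 1 else 0

/-- The plaquette variable `U_p = U_{x,μ} U_{x+μ̂,ν} U_{x+ν̂,μ}⁻¹ U_{x,ν}⁻¹`. -/
noncomputable def plaqSU (L : Fin d → ℕ) (U : Config L N) (x : Site L) (μ ν : Fin d) : SU N :=
  U (x, μ) * U (x + e L μ, ν) * (U (x + e L ν, μ))⁻¹ * (U (x, ν))⁻¹

/-- The Wilson action `(β/N) Σ_x Σ_{μ<ν} Re Tr U_p`. -/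
noncomputable def S0 (L : Fin d → ℕ) [∀ i, NeZero (L i)] (β : ℝ) (U : Config L N) : ℝ :=
  β / N * ∑ x : Site L, ∑ μ : Fin d, ∑ ν : Fin d,
    if μ < ν then ((toM (plaqSU L U x μ ν)).trace).re else 0

/-- The Gibbs weight `exp(S0)`. -/
noncomputable def wt (L : Fin d → ℕ) [∀ i, NeZero (L i)] (β : ℝ) (U : Config L N) : ℝ :=
  Real.exp (S0 L β U)

/-- The product over all links of the single-link measure `μH`. -/
noncomputable def Pm (L : Fin d → ℕ) [∀ i, NeZero (L i)] (μH : Measure (SU N))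
    [IsProbabilityMeasure μH] : Measure (Config L N) :=
  Measure.pi fun _ => μH

/-- The partition function `Z_Λ`. -/
noncomputable def Zpart (L : Fin d → ℕ) [∀ i, NeZero (L i)] (μH : Measure (SU N))
    [IsProbabilityMeasure μH] (β : ℝ) : ℝ :=
  ∫ U, wt L β U ∂(Pm L μH)

/-- Expectation value of a complex observable. -/
noncomputable def expecC (L : Fin d → ℕ) [∀ i, NeZero (L i)] (μH : Measure (SU N))
    [IsProbabilityMeasure μH] (β : ℝ) (f : Config L N → ℂ) : ℂ :=
  (∫ U, f U * (wt L β U : ℂ) ∂(Pm L μH)) / (Zpart L μH β : ℂ)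

/-- Expectation value of a real observable. -/
noncomputable def expecR (L : Fin d → ℕ) [∀ i, NeZero (L i)] (μH : Measure (SU N))
    [IsProbabilityMeasure μH] (β : ℝ) (f : Config L N → ℝ) : ℝ :=
  (∫ U, f U * wt L β U ∂(Pm L μH)) / Zpart L μH β

/-- The ordered product of link variables along a straight path of `l` links starting
at `x` in direction `μ`. -/
noncomputable def pathProd (L : Fin d → ℕ) (U : Config L N) (x : Site L) (μ : Fin d) (l : ℕ) :
    SU N :=
  ((List.range l).map fun j => U (x + j • e L μ, μ)).prod

/-- The holonomy around the rectangular loop with corner `x`, sides `lμ`, `lν` in the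
`μ`-`ν` coordinate plane. -/
noncomputable def rectHol (L : Fin d → ℕ) (U : Config L N) (x : Site L) (μ ν : Fin d)
    (lμ lν : ℕ) : SU N :=
  pathProd L U x μ lμ * pathProd L U (x + lμ • e L μ) ν lν *
    (pathProd L U (x + lν • e L ν) μ lμ)⁻¹ * (pathProd L U x ν lν)⁻¹

/-- The vortex creation operator `O^[k][V]` for the vortex with μν-orientation and
coordinates `(c1, c2)`:
`exp((β/N) Σ_{p ⊂ V} [Re Tr(z^k U_p) − Re Tr U_p])`. -/
noncomputable def Ovort (L : Fin d → ℕ) [∀ i, NeZero (L i)] (β : ℝ) {μ ν : Fin d}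
    (c1 : ZMod (L μ)) (c2 : ZMod (L ν)) (k : ℕ) (U : Config L N) : ℝ :=
  Real.exp (β / N * ∑ x : Site L,
    if x μ = c1 ∧ x ν = c2 then
      (zc N ^ k * (toM (plaqSU L U x μ ν)).trace).re - ((toM (plaqSU L U x μ ν)).trace).re
    else 0)

/-- The electric flux creation operator `F^[m][V] = (1/N) Σ_k z^{mk} O^[k][V]`. -/
noncomputable def Fop (L : Fin d → ℕ) [∀ i, NeZero (L i)] (β : ℝ) {μ ν : Fin d}
    (c1 : ZMod (L μ)) (c2 : ZMod (L ν)) (m : ℕ) (U : Config L N) : ℂ :=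
  (N : ℂ)⁻¹ * ∑ k ∈ Finset.range N, zc N ^ (m * k) * (Ovort L β c1 c2 k U : ℂ)

/-- The twisted partition function `Z_Λ^[k] = Z_Λ ⟨O^[k][V]⟩`. -/
noncomputable def Ztw (L : Fin d → ℕ) [∀ i, NeZero (L i)] (μH : Measure (SU N))
    [IsProbabilityMeasure μH] (β : ℝ) {μ ν : Fin d} (c1 : ZMod (L μ)) (c2 : ZMod (L ν))
    (k : ℕ) : ℝ :=
  ∫ U, Ovort L β c1 c2 k U * wt L β U ∂(Pm L μH)

end TYLGT

namespace TYLGT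

section Prelim

variable {d N : ℕ}

lemma zc_ne_zero (N : ℕ) : zc N ≠ 0 := Complex.exp_ne_zero _

lemma zc_isPrimitiveRoot (hN : N ≠ 0) : IsPrimitiveRoot (zc N) N :=
  Complex.isPrimitiveRoot_exp N hN

lemma star_zc_zpow (hN : N ≠ 0) (n : ℤ) : star (zc N ^ n) = zc N ^ (-n) := by
  have h1 : ‖zc N ^ n‖ = 1 := by
    rw [norm_zpow, (zc_isPrimitiveRoot hN).norm'_eq_one hN, one_zpow]
  rw [zpow_neg, Complex.inv_eq_conj h1]
  rfl

/-- The central element `z^n • 1` of `SU(N)`. -/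
noncomputable def centerElt (hN : N ≠ 0) (n : ℤ) : SU N :=
  ⟨⟨zc N ^ n • 1, by
    rw [Matrix.mem_unitaryGroup_iff, star_smul, star_one, star_zc_zpow hN, smul_mul_smul_comm,
      mul_one, ← zpow_add₀ (zc_ne_zero N), add_neg_cancel, zpow_zero, one_smul]⟩, by
    change Matrix.det (zc N ^ n • (1 : Matrix (Fin N) (Fin N) ℂ)) = 1
    rw [Matrix.det_smul, Matrix.det_one, mul_one, Fintype.card_fin, ← zpow_natCast, zpow_comm,
      zpow_natCast, (zc_isPrimitiveRoot hN).pow_eq_one, one_zpow]⟩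

lemma toM_mul (A B : SU N) : toM (A * B) = toM A * toM B := rfl

lemma toM_inv (A : SU N) : toM A⁻¹ = star (toM A) := rfl

lemma toM_centerElt_mul (hN : N ≠ 0) (n : ℤ) (A : SU N) :
    toM (centerElt hN n * A) = zc N ^ n • toM A := by
  rw [toM_mul]
  change (zc N ^ n • (1 : Matrix (Fin N) (Fin N) ℂ)) * toM A = _
  rw [smul_mul_assoc, one_mul]

lemma norm_toM_apply_le (A : SU N) (i j : Fin N) : ‖toM A i j‖ ≤ 1 :=
  entry_norm_bound_of_unitary (A : Matrix.unitaryGroup (Fin N) ℂ).2 i j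

lemma norm_trace_toM_le (A : SU N) : ‖(toM A).trace‖ ≤ N := by
  refine (norm_sum_le _ _).trans ?_
  refine (Finset.sum_le_sum fun i _ => norm_toM_apply_le A i i).trans ?_
  simp

lemma measurable_toM_apply (i j : Fin N) : Measurable fun A : SU N => toM A i j := by
  have h : Measurable fun A : SU N =>
      ((A : Matrix.unitaryGroup (Fin N) ℂ) : Matrix (Fin N) (Fin N) ℂ) :=
    measurable_subtype_coe.comp measurable_subtype_coe
  exact (measurable_pi_apply j).comp ((measurable_pi_apply (X := fun _ => Fin N → ℂ) i).comp h)

lemma measurable_SU_of_toM {α : Type*} [MeasurableSpace α] {f : α → SU N}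
    (h : ∀ i j, Measurable fun a => toM (f a) i j) : Measurable f := by
  refine Measurable.subtype_mk (Measurable.subtype_mk ?_ (h := fun a => (f a).1.2))
    (h := fun a => (f a).2)
  exact measurable_pi_iff.2 fun i => measurable_pi_iff.2 fun j => h i j

lemma measurable_SU_mul {α : Type*} [MeasurableSpace α] {f g : α → SU N}
    (hf : Measurable f) (hg : Measurable g) : Measurable fun a => f a * g a := by
  refine measurable_SU_of_toM fun i j => ?_
  simp only [toM_mul, Matrix.mul_apply]
  exact Finset.measurable_sum _ fun k _ =>
    ((measurable_toM_apply i k).comp hf).mul ((measurable_toM_apply k j).comp hg)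

lemma measurable_SU_inv {α : Type*} [MeasurableSpace α] {f : α → SU N}
    (hf : Measurable f) : Measurable fun a => (f a)⁻¹ := by
  refine measurable_SU_of_toM fun i j => ?_
  simp only [toM_inv, Matrix.star_apply]
  exact continuous_star.measurable.comp ((measurable_toM_apply j i).comp hf)

lemma measurable_trace_plaqSU (L : Fin d → ℕ) (x : Site L) (μ ν : Fin d) :
    Measurable fun U : Config L N => (toM (plaqSU L U x μ ν)).trace := by
  have h : Measurable fun U : Config L N => plaqSU L U x μ ν :=
    measurable_SU_mul (measurable_SU_mul (measurable_SU_mul (measurable_pi_apply _)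
      (measurable_pi_apply _)) (measurable_SU_inv (measurable_pi_apply _)))
      (measurable_SU_inv (measurable_pi_apply _))
  exact Finset.measurable_sum _ fun i _ => (measurable_toM_apply i i).comp h

/-- Left multiplication on `SU(N)` as a measurable equivalence. -/
noncomputable def mulLeftSU (g : SU N) : SU N ≃ᵐ SU N where
  toEquiv := Equiv.mulLeft g
  measurable_toFun := measurable_SU_mul measurable_const measurable_id
  measurable_invFun := measurable_SU_mul measurable_const measurable_id

lemma trace_plaqSU_twist (L : Fin d → ℕ) (hN : N ≠ 0) (s : Site L × Fin d → ℤ) (U : Config L N)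
    (x : Site L) (ρ σ : Fin d) :
    (toM (plaqSU L (fun b => centerElt hN (s b) * U b) x ρ σ)).trace =
      zc N ^ (s (x, ρ) + s (x + e L ρ, σ) - s (x + e L σ, ρ) - s (x, σ)) *
        (toM (plaqSU L U x ρ σ)).trace := by
  rw [← smul_eq_mul, ← Matrix.trace_smul]
  congr 1
  simp only [plaqSU, toM_mul _ (_ : SU N)⁻¹, toM_mul (centerElt hN _ * _) (centerElt hN _ * _),
    toM_mul (U _) (U _), toM_inv, toM_centerElt_mul, star_smul, star_zc_zpow hN,
    smul_mul_smul_comm, sub_eq_add_neg, zpow_add₀ (zc_ne_zero N)]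

lemma add_e_apply {L : Fin d → ℕ} (x : Site L) (ρ i : Fin d) :
    (x + e L ρ) i = if i = ρ then x i + 1 else x i := by
  by_cases h : i = ρ <;> simp [e, h]

end Prelim

section Twisted

variable {d N : ℕ} (L : Fin d → ℕ) [∀ i, NeZero (L i)]

/-- The Wilson action in a background of center fluxes: `U_p` is replaced by `z^{h(p)} U_p`. -/
noncomputable def fluxAction (β : ℝ) (h : Site L → Fin d → Fin d → ℤ) (U : Config L N) : ℝ :=
  β / N * ∑ x : Site L, ∑ ρ : Fin d, ∑ σ : Fin d,
    if ρ < σ then (zc N ^ h x ρ σ * (toM (plaqSU L U x ρ σ)).trace).re else 0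

/-- The partition function in a background of center fluxes. -/
noncomputable def fluxPart (μH : Measure (SU N)) [IsProbabilityMeasure μH] (β : ℝ)
    (h : Site L → Fin d → Fin d → ℤ) : ℝ :=
  ∫ U, Real.exp (fluxAction L β h U) ∂(Pm L μH)

variable {L}

lemma fluxAction_congr (β : ℝ) {h h' : Site L → Fin d → Fin d → ℤ} (U : Config L N)
    (H : ∀ x ρ σ, ρ < σ → zc N ^ h x ρ σ = zc N ^ h' x ρ σ) :
    fluxAction L β h U = fluxAction L β h' U := by
  unfold fluxAction
  congr 1
  refine Finset.sum_congr rfl fun x _ => Finset.sum_congr rfl fun ρ _ =>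
    Finset.sum_congr rfl fun σ _ => ?_
  split_ifs with hlt
  · rw [H x ρ σ hlt]
  · rfl

/-- Center fluxes differing by a coboundary have the same partition function. -/
lemma fluxPart_coboundary (hN : N ≠ 0) (μH : Measure (SU N)) [IsProbabilityMeasure μH]
    (hHaar : ∀ g : SU N, Measure.map (fun u => g * u) μH = μH) (β : ℝ)
    {h h' : Site L → Fin d → Fin d → ℤ} (s : Site L × Fin d → ℤ)
    (H : ∀ x ρ σ, ρ < σ →
      h' x ρ σ = h x ρ σ + (s (x, ρ) + s (x + e L ρ, σ) - s (x + e L σ, ρ) - s (x, σ))) :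
    fluxPart L μH β h' = fluxPart L μH β h := by
  let T : Config L N ≃ᵐ Config L N :=
    MeasurableEquiv.piCongrRight fun b => mulLeftSU (centerElt hN (s b))
  have hT : MeasurePreserving T (Pm L μH) (Pm L μH) :=
    measurePreserving_pi (fun _ => μH) (fun _ => μH) fun b =>
      ⟨(mulLeftSU (centerElt hN (s b))).measurable, hHaar _⟩
  unfold fluxPart
  rw [← hT.integral_comp' (fun U => Real.exp (fluxAction L β h U))]
  congr 1 with U
  congr 1
  have key : fluxAction L β h (T U) = fluxAction L β (fun x ρ σ =>
      h x ρ σ + (s (x, ρ) + s (x + e L ρ, σ) - s (x + e L σ, ρ) - s (x, σ))) U := by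
    unfold fluxAction
    congr 1
    refine Finset.sum_congr rfl fun x _ => Finset.sum_congr rfl fun ρ _ =>
      Finset.sum_congr rfl fun σ _ => ?_
    have hp := trace_plaqSU_twist L hN s U x ρ σ
    rw [zpow_add₀ (zc_ne_zero N), mul_assoc, ← hp]
    rfl
  rw [key]
  exact fluxAction_congr β U fun x ρ σ hlt => by rw [H x ρ σ hlt]

/-- The flux background of a vortex of strength `k`. -/
def vortexFlux (L : Fin d → ℕ) (μ ν : Fin d) (c : ZMod (L μ) × ZMod (L ν)) (k : ℤ) (x : Site L)
    (ρ σ : Fin d) : ℤ :=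
  if (ρ = μ ∧ σ = ν) ∧ (x μ = c.1 ∧ x ν = c.2) then k else 0

lemma fluxPart_vortex_step_fst (hN : N ≠ 0) (μH : Measure (SU N)) [IsProbabilityMeasure μH]
    (hHaar : ∀ g : SU N, Measure.map (fun u => g * u) μH = μH) (β : ℝ) {μ ν : Fin d}
    (hμν : μ < ν) (h : Site L → Fin d → Fin d → ℤ) (a : ZMod (L μ)) (b : ZMod (L ν)) (k : ℤ) :
    fluxPart L μH β (h + vortexFlux L μ ν (a + 1, b) k) =
      fluxPart L μH β (h + vortexFlux L μ ν (a, b) k) := by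
  refine fluxPart_coboundary hN μH hHaar β
    (fun y => if y.2 = ν ∧ y.1 μ = a + 1 ∧ y.1 ν = b then -k else 0) fun x ρ σ hlt => ?_
  simp only [Pi.add_apply (f := h), add_e_apply]
  have h1 := hμν.ne
  have h2 := hμν.ne'
  by_cases hσ : σ = ν
  · subst hσ
    have h3 := hlt.ne
    have h4 := hlt.ne'
    by_cases hρ : ρ = μ
    · subst hρ
      simp only [Pi.add_apply, vortexFlux, h1, h2, true_and, false_and, if_true, if_false,
        add_left_inj]
      split_ifs <;> simp
    · simp [vortexFlux, h3, h4, hρ, Ne.symm hρ]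
  · by_cases hρ : ρ = ν
    · subst hρ
      have h5 : μ ≠ σ := (hμν.trans hlt).ne
      simp [vortexFlux, hσ, h2, h5, Ne.symm hσ]
    · simp [vortexFlux, hσ, hρ]

lemma fluxPart_vortex_step_snd (hN : N ≠ 0) (μH : Measure (SU N)) [IsProbabilityMeasure μH]
    (hHaar : ∀ g : SU N, Measure.map (fun u => g * u) μH = μH) (β : ℝ) {μ ν : Fin d}
    (hμν : μ < ν) (h : Site L → Fin d → Fin d → ℤ) (a : ZMod (L μ)) (b : ZMod (L ν)) (k : ℤ) :
    fluxPart L μH β (h + vortexFlux L μ ν (a, b + 1) k) =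
      fluxPart L μH β (h + vortexFlux L μ ν (a, b) k) := by
  refine fluxPart_coboundary hN μH hHaar β
    (fun y => if y.2 = μ ∧ y.1 μ = a ∧ y.1 ν = b + 1 then k else 0) fun x ρ σ hlt => ?_
  simp only [Pi.add_apply (f := h), add_e_apply]
  have h1 := hμν.ne
  have h2 := hμν.ne'
  by_cases hρ : ρ = μ
  · subst hρ
    have h3 := hlt.ne
    have h4 := hlt.ne'
    by_cases hσ : σ = ν
    · subst hσ
      simp only [Pi.add_apply, vortexFlux, h1, h2, true_and, false_and, if_true, if_false,
        add_left_inj]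
      split_ifs <;> simp
    · simp [vortexFlux, h3, h4, hσ, Ne.symm hσ]
  · by_cases hσ : σ = μ
    · subst hσ
      have h5 : ν ≠ ρ := (hlt.trans hμν).ne'
      simp [vortexFlux, hρ, h1, h5, Ne.symm hρ]
    · simp [vortexFlux, hσ, hρ]

/-- Vortices may be moved freely to homologous positions. -/
lemma fluxPart_vortex_move (hN : N ≠ 0) (μH : Measure (SU N)) [IsProbabilityMeasure μH]
    (hHaar : ∀ g : SU N, Measure.map (fun u => g * u) μH = μH) (β : ℝ) {μ ν : Fin d}
    (hμν : μ < ν) (h : Site L → Fin d → Fin d → ℤ) (c c' : ZMod (L μ) × ZMod (L ν)) (k : ℤ) :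
    fluxPart L μH β (h + vortexFlux L μ ν c' k) =
      fluxPart L μH β (h + vortexFlux L μ ν c k) := by
  have key : ∀ (a : ZMod (L μ)) (b : ZMod (L ν)), fluxPart L μH β (h + vortexFlux L μ ν (a, b) k) =
      fluxPart L μH β (h + vortexFlux L μ ν (0, 0) k) := by
    intro a b
    rw [← ZMod.natCast_zmod_val a, ← ZMod.natCast_zmod_val b]
    generalize a.val = i
    generalize b.val = j
    induction i with
    | zero =>
      induction j with
      | zero => simp
      | succ j ih => rw [← ih, Nat.cast_succ, fluxPart_vortex_step_snd hN μH hHaar β hμν]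
    | succ i ih => rw [← ih, Nat.cast_succ, fluxPart_vortex_step_fst hN μH hHaar β hμν]
  exact (key c'.1 c'.2).trans (key c.1 c.2).symm

lemma measurable_fluxAction (β : ℝ) (h : Site L → Fin d → Fin d → ℤ) :
    Measurable (fluxAction (N := N) L β h) := by
  refine Measurable.const_mul ?_ _
  refine Finset.measurable_sum _ fun x _ => Finset.measurable_sum _ fun ρ _ =>
    Finset.measurable_sum _ fun σ _ => ?_
  split_ifs
  · exact Complex.measurable_re.comp ((measurable_trace_plaqSU L x ρ σ).const_mul _)
  · exact measurable_const

lemma exists_fluxAction_le (hN : N ≠ 0) (β : ℝ) (h : Site L → Fin d → Fin d → ℤ) :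
    ∃ C : ℝ, ∀ U : Config L N, fluxAction L β h U ≤ C := by
  refine ⟨|β / N| * ∑ _x : Site L, ∑ _ρ : Fin d, ∑ _σ : Fin d, (N : ℝ), fun U => ?_⟩
  refine (le_abs_self _).trans ?_
  unfold fluxAction
  rw [abs_mul]
  gcongr
  refine (Finset.abs_sum_le_sum_abs _ _).trans (Finset.sum_le_sum fun x _ => ?_)
  refine (Finset.abs_sum_le_sum_abs _ _).trans (Finset.sum_le_sum fun ρ _ => ?_)
  refine (Finset.abs_sum_le_sum_abs _ _).trans (Finset.sum_le_sum fun σ _ => ?_)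
  split_ifs
  · refine (Complex.abs_re_le_norm _).trans ?_
    rw [norm_mul, norm_zpow, (zc_isPrimitiveRoot hN).norm'_eq_one hN, one_zpow, one_mul]
    exact norm_trace_toM_le _
  · simp

lemma integrable_exp_fluxAction (hN : N ≠ 0) (μH : Measure (SU N)) [IsProbabilityMeasure μH]
    (β : ℝ) (h : Site L → Fin d → Fin d → ℤ) :
    Integrable (fun U : Config L N => Real.exp (fluxAction L β h U)) (Pm L μH) := by
  have : IsProbabilityMeasure (Pm L μH) := by unfold Pm; infer_instance
  obtain ⟨C, hC⟩ := exists_fluxAction_le (L := L) hN β h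
  refine Integrable.of_bound (measurable_fluxAction β h).exp.aestronglyMeasurable (Real.exp C)
    (Filter.Eventually.of_forall fun U => ?_)
  rw [Real.norm_eq_abs, Real.abs_exp]
  exact Real.exp_le_exp.2 (hC U)

/-- Inserting a vortex where the background carries no flux adds the vortex flux. -/
lemma Ovort_mul_exp_fluxAction (β : ℝ) {μ ν : Fin d} (hμν : μ < ν)
    (h : Site L → Fin d → Fin d → ℤ) (c : ZMod (L μ) × ZMod (L ν)) (k : ℕ)
    (hc : ∀ x : Site L, x μ = c.1 → x ν = c.2 → h x μ ν = 0) (U : Config L N) :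
    Ovort L β c.1 c.2 k U * Real.exp (fluxAction L β h U) =
      Real.exp (fluxAction L β (h + vortexFlux L μ ν c k) U) := by
  rw [Ovort, ← Real.exp_add, fluxAction, fluxAction, ← mul_add, ← Finset.sum_add_distrib]
  congr 2
  refine Finset.sum_congr rfl fun x _ => ?_
  rw [← eq_sub_iff_add_eq, ← Finset.sum_sub_distrib, Finset.sum_eq_single μ]
  · rw [← Finset.sum_sub_distrib, Finset.sum_eq_single ν]
    · simp only [Pi.add_apply, vortexFlux, hμν, if_true, true_and]
      split_ifs with hx
      · simp [hc x hx.1 hx.2]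
      · simp
    · intro σ _ hσ
      simp [vortexFlux, hσ]
    · simp
  · intro ρ _ hρ
    simp [vortexFlux, hρ]
  · simp

lemma wt_eq_exp_fluxAction (β : ℝ) (U : Config L N) :
    wt L β U = Real.exp (fluxAction L β 0 U) := by
  simp [wt, S0, fluxAction]

lemma Ovort_mul_wt (β : ℝ) {μ ν : Fin d} (hμν : μ < ν) (c : ZMod (L μ) × ZMod (L ν)) (k : ℕ)
    (U : Config L N) :
    Ovort L β c.1 c.2 k U * wt L β U = Real.exp (fluxAction L β (vortexFlux L μ ν c k) U) := by
  rw [wt_eq_exp_fluxAction, Ovort_mul_exp_fluxAction β hμν _ _ _ (by simp), zero_add]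

lemma Ovort_mul_Ovort_mul_wt (β : ℝ) {μ ν : Fin d} (hμν : μ < ν)
    {c c' : ZMod (L μ) × ZMod (L ν)} (hcc : c ≠ c') (k k' : ℕ) (U : Config L N) :
    Ovort L β c.1 c.2 k U * Ovort L β c'.1 c'.2 k' U * wt L β U =
      Real.exp (fluxAction L β (vortexFlux L μ ν c k + vortexFlux L μ ν c' k') U) := by
  rw [mul_comm (Ovort L β c.1 c.2 k U), mul_assoc, Ovort_mul_wt β hμν,
    Ovort_mul_exp_fluxAction β hμν]
  intro x h1 h2
  refine if_neg fun hx => hcc ?_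
  exact Prod.ext (hx.2.1.symm.trans h1) (hx.2.2.symm.trans h2)

lemma fluxPart_two_vortices (hN : N ≠ 0) (μH : Measure (SU N)) [IsProbabilityMeasure μH]
    (hHaar : ∀ g : SU N, Measure.map (fun u => g * u) μH = μH) (β : ℝ) {μ ν : Fin d}
    (hμν : μ < ν) (c c' : ZMod (L μ) × ZMod (L ν)) (k k' : ℕ) :
    fluxPart L μH β (vortexFlux L μ ν c k + vortexFlux L μ ν c' k') =
      fluxPart L μH β (vortexFlux L μ ν c ((k + k' : ℕ) : ℤ)) := by
  rw [fluxPart_vortex_move hN μH hHaar β hμν _ c c']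
  congr 1
  funext x ρ σ
  simp only [Pi.add_apply, vortexFlux]
  split_ifs <;> simp

lemma fluxPart_vortex_periodic (hN : N ≠ 0) (μH : Measure (SU N)) [IsProbabilityMeasure μH]
    (β : ℝ) {μ ν : Fin d} (c : ZMod (L μ) × ZMod (L ν)) (k : ℕ) :
    fluxPart L μH β (vortexFlux L μ ν c ((k + N : ℕ) : ℤ)) =
      fluxPart L μH β (vortexFlux L μ ν c (k : ℤ)) := by
  unfold fluxPart
  congr 1 with U
  congr 1
  refine fluxAction_congr β U fun x ρ σ _ => ?_
  unfold vortexFlux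
  split_ifs
  · rw [zpow_natCast, zpow_natCast, pow_add, (zc_isPrimitiveRoot hN).pow_eq_one, mul_one]
  · rfl

end Twisted

section Fourier

lemma sum_range_add_of_periodic {M : Type*} [AddCommGroup M] {N : ℕ} {f : ℕ → M}
    (hf : ∀ k, f (k + N) = f k) (k : ℕ) :
    ∑ j ∈ Finset.range N, f (k + j) = ∑ j ∈ Finset.range N, f j := by
  induction k with
  | zero => simp
  | succ k ih =>
    have h1 := Finset.sum_range_succ (fun j => f (k + j)) N
    have h2 := Finset.sum_range_succ' (fun j => f (k + j)) N
    simp only [add_zero, hf] at h1 h2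
    rw [← ih, ← add_right_cancel_iff (a := f k), ← h1, h2]
    simp only [add_assoc, add_comm 1]

lemma sum_range_root_pow {N : ℕ} (hN : N ≠ 0) {l m : ℕ} (hl : l < N) (hm : m < N) :
    ∑ k ∈ Finset.range N, (zc N ^ l / zc N ^ m) ^ k = if l = m then (N : ℂ) else 0 := by
  have hz := zc_isPrimitiveRoot hN
  split_ifs with h
  · subst h
    simp [div_self (pow_ne_zero l (zc_ne_zero N))]
  · have hne : zc N ^ l / zc N ^ m ≠ 1 := fun hw =>
      h (hz.pow_inj hl hm ((div_eq_one_iff_eq (pow_ne_zero m (zc_ne_zero N))).1 hw))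
    rw [geom_sum_eq hne, div_pow, ← pow_mul, ← pow_mul, mul_comm l, mul_comm m, pow_mul, pow_mul,
      hz.pow_eq_one]
    simp

lemma sum_sum_root_pow_mul {N : ℕ} (hN : N ≠ 0) {l m : ℕ} (hl : l < N) (hm : m < N) {G : ℕ → ℂ}
    (hG : ∀ k, G (k + N) = G k) :
    ∑ k ∈ Finset.range N, ∑ k' ∈ Finset.range N,
        zc N ^ (l * k) * zc N ^ (m * k') * G (k + k') =
      (if l = m then (N : ℂ) else 0) * ∑ j ∈ Finset.range N, zc N ^ (m * j) * G j := by
  have hz := zc_ne_zero N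
  rw [← sum_range_root_pow hN hl hm, Finset.sum_mul]
  refine Finset.sum_congr rfl fun k _ => ?_
  have hper : ∀ j, zc N ^ (m * (j + N)) * G (j + N) = zc N ^ (m * j) * G j := fun j => by
    rw [hG, mul_add, pow_add, mul_comm m N, pow_mul _ N m, (zc_isPrimitiveRoot hN).pow_eq_one,
      one_pow, mul_one]
  rw [← sum_range_add_of_periodic (f := fun j => zc N ^ (m * j) * G j) hper k, Finset.mul_sum]
  refine Finset.sum_congr rfl fun k' _ => ?_
  rw [div_pow, ← pow_mul, ← pow_mul, mul_add, pow_add]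
  field_simp

lemma sum_Fop {d N : ℕ} (hN : N ≠ 0) (L : Fin d → ℕ) [∀ i, NeZero (L i)] (β : ℝ) {μ ν : Fin d}
    (c1 : ZMod (L μ)) (c2 : ZMod (L ν)) (U : Config L N) :
    ∑ j ∈ Finset.range N, Fop L β c1 c2 j U = 1 := by
  have hN' : (N : ℂ) ≠ 0 := Nat.cast_ne_zero.2 hN
  simp only [Fop]
  rw [← Finset.mul_sum, Finset.sum_comm, Finset.sum_eq_single 0]
  · simp [Ovort, hN']
  · intro k hk hk0
    have h := sum_range_root_pow hN (Finset.mem_range.1 hk) (Nat.pos_of_ne_zero hN)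
    rw [if_neg hk0, pow_zero, div_one] at h
    rw [← Finset.sum_mul]
    simp only [mul_comm _ k, pow_mul, h, zero_mul]
  · intro h
    exact absurd (Finset.mem_range.2 (Nat.pos_of_ne_zero hN)) h

end Fourier

section Expectation

variable {d N : ℕ} {L : Fin d → ℕ} [∀ i, NeZero (L i)]

lemma integral_Fop_mul_wt (hN : N ≠ 0) (μH : Measure (SU N)) [IsProbabilityMeasure μH] (β : ℝ)
    {μ ν : Fin d} (hμν : μ < ν) (c : ZMod (L μ) × ZMod (L ν)) (m : ℕ) :
    ∫ U, Fop L β c.1 c.2 m U * (wt L β U : ℂ) ∂(Pm L μH) =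
      (N : ℂ)⁻¹ * ∑ k ∈ Finset.range N,
        zc N ^ (m * k) * (fluxPart L μH β (vortexFlux L μ ν c k) : ℂ) := by
  have h : ∀ U : Config L N, Fop L β c.1 c.2 m U * (wt L β U : ℂ) =
      (N : ℂ)⁻¹ * ∑ k ∈ Finset.range N, zc N ^ (m * k) *
        (Real.exp (fluxAction L β (vortexFlux L μ ν c k) U) : ℂ) := fun U => by
    simp only [← Ovort_mul_wt β hμν, Fop, Complex.ofReal_mul, mul_assoc, Finset.sum_mul]
  simp only [h]
  rw [integral_const_mul, integral_finsetSum _ fun k _ =>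
    (integrable_exp_fluxAction hN μH β _).ofReal.const_mul _]
  simp only [integral_const_mul, integral_complex_ofReal, fluxPart]

lemma integral_Fop_mul_Fop_mul_wt (hN : N ≠ 0) (μH : Measure (SU N)) [IsProbabilityMeasure μH]
    (hHaar : ∀ g : SU N, Measure.map (fun u => g * u) μH = μH) (β : ℝ)
    {μ ν : Fin d} (hμν : μ < ν) {c c' : ZMod (L μ) × ZMod (L ν)} (hcc : c ≠ c') (l m : ℕ) :
    ∫ U, Fop L β c.1 c.2 l U * Fop L β c'.1 c'.2 m U * (wt L β U : ℂ) ∂(Pm L μH) =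
      (N : ℂ)⁻¹ * (N : ℂ)⁻¹ * ∑ k ∈ Finset.range N, ∑ k' ∈ Finset.range N,
        zc N ^ (l * k) * zc N ^ (m * k') *
          (fluxPart L μH β (vortexFlux L μ ν c ((k + k' : ℕ) : ℤ)) : ℂ) := by
  have h : ∀ U : Config L N,
      Fop L β c.1 c.2 l U * Fop L β c'.1 c'.2 m U * (wt L β U : ℂ) =
      (N : ℂ)⁻¹ * (N : ℂ)⁻¹ * ∑ k ∈ Finset.range N, ∑ k' ∈ Finset.range N,
        zc N ^ (l * k) * zc N ^ (m * k') * (Real.exp (fluxAction L β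
          (vortexFlux L μ ν c k + vortexFlux L μ ν c' k') U) : ℂ) := fun U => by
    simp only [← Ovort_mul_Ovort_mul_wt β hμν hcc, Fop, Complex.ofReal_mul]
    rw [mul_mul_mul_comm, Finset.sum_mul_sum, mul_assoc, Finset.sum_mul]
    simp only [Finset.sum_mul]
    congr 1
    exact Finset.sum_congr rfl fun k _ => Finset.sum_congr rfl fun k' _ => by ring
  simp only [h]
  have hint : ∀ k k' : ℕ, Integrable (fun U : Config L N =>
      zc N ^ (l * k) * zc N ^ (m * k') * (Real.exp (fluxAction L β
        (vortexFlux L μ ν c k + vortexFlux L μ ν c' k') U) : ℂ)) (Pm L μH) := fun k k' =>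
    (integrable_exp_fluxAction hN μH β _).ofReal.const_mul _
  rw [integral_const_mul, integral_finsetSum _ fun k _ =>
    integrable_finsetSum _ fun k' _ => hint k k']
  congr 1
  refine Finset.sum_congr rfl fun k _ => ?_
  rw [integral_finsetSum _ fun k' _ => hint k k']
  refine Finset.sum_congr rfl fun k' _ => ?_
  rw [integral_const_mul, integral_complex_ofReal,
    ← fluxPart_two_vortices hN μH hHaar β hμν c c' k k', fluxPart]

end Expectation

/-- For two distinct homologous vortices `V` (coordinates `c`) and `V′` (coordinates `c′`),
the electric-flux operators behave as orthogonal projections: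
`⟨F^[l][V] · F^[m][V′]⟩ = δ^{(N)}_{l,m} ⟨F^[l][V]⟩`, and `Σ_{m<N} F^[m][V] = 1`
identically. -/
theorem flux_projection_rule
    {d N : ℕ} (hN : 2 ≤ N) (L : Fin d → ℕ) [∀ i, NeZero (L i)]
    (β : ℝ)
    (μH : Measure (SU N)) [IsProbabilityMeasure μH]
    (hHaar : ∀ g : SU N, Measure.map (fun u => g * u) μH = μH)
    (μ ν : Fin d) (hμν : μ < ν)
    (c c' : ZMod (L μ) × ZMod (L ν)) (hcc : c ≠ c')
    (l m : ℕ) (hl : l < N) (hm : m < N) :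
    (expecC L μH β (fun U => Fop L β c.1 c.2 l U * Fop L β c'.1 c'.2 m U) =
        if l % N = m % N then expecC L μH β (Fop L β c.1 c.2 l) else 0) ∧
      (∀ U : Config L N, ∑ j ∈ Finset.range N, Fop L β c.1 c.2 j U = 1) := by
  have hN0 : N ≠ 0 := by omega
  have hNC : (N : ℂ) ≠ 0 := Nat.cast_ne_zero.2 hN0
  refine ⟨?_, sum_Fop hN0 L β c.1 c.2⟩
  rw [Nat.mod_eq_of_lt hl, Nat.mod_eq_of_lt hm]
  unfold expecC
  rw [integral_Fop_mul_Fop_mul_wt hN0 μH hHaar β hμν hcc, integral_Fop_mul_wt hN0 μH β hμν,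
    sum_sum_root_pow_mul hN0 hl hm
      (G := fun j => (fluxPart L μH β (vortexFlux L μ ν c (j : ℤ)) : ℂ))
      fun k => by rw [fluxPart_vortex_periodic hN0]]
  split_ifs with h
  · subst h
    rw [← mul_assoc, mul_assoc _ _ (N : ℂ), inv_mul_cancel₀ hNC, mul_one]
  · simp

end TYLGT
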